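/- Let G be a group, let Λ_i = (V_i, E_i, s_i, t_i) and Λ_j = (V_j, E_j, s_j, t_j) be finite oriented graphs, and let ι⁰ : V_i → V_j and φ : E_i → List E_j be such that each φ(e) is nonempty and is a path from ι⁰(s_i(e)) to ι⁰(t_i(e)) (sources and targets of consecutive entries chaining as in a path). Let R : (E_j → G) → (E_i → G) be R(a)(e) = the ordered product of a over φ(e). If ψ : (E_i → G) → ℂ is gauge invariant, i.e. ψ(h · a) = ψ(a) for all h : V_i → G and a : E_i → G, then ψ ∘ R is gauge invariant for Λ_j, i.e. (ψ ∘ R)(g · b) = (ψ ∘ R)(b) for all g : V_j → G and b : E_j → G. -/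

import Mathlib

/-- Along a nonempty path, the ordered product of a gauge-transformed configuration only changes
by the gauge factors at the endpoints of the path. -/
theorem prod_map_gauge_of_isChain {G V E : Type*} [Group G] (s t : E → V) (g : V → G) (b : E → G)
    (l : List E) (x y : V) (hl : l.IsChain fun f f' => t f = s f')
    (hx : l.head?.map s = some x) (hy : l.getLast?.map t = some y) :
    (l.map fun f => g (s f) * b f * (g (t f))⁻¹).prod = g x * (l.map b).prod * (g y)⁻¹ := by
  induction l generalizing x with
  | nil => simp at hx
  | cons f l ih =>
    obtain rfl : s f = x := by simpa using hx
    cases l with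
    | nil =>
      obtain rfl : t f = y := by simpa using hy
      simp
    | cons f' l =>
      rw [List.isChain_cons_cons] at hl
      rw [List.getLast?_cons_cons] at hy
      rw [List.map_cons, List.prod_cons, ih (t f) hl.2 (by simp [hl.1]) hy,
        List.map_cons (a := f) (l := f' :: l), List.prod_cons]
      simp only [mul_assoc, inv_mul_cancel_left]

/-- If `ψ` is a gauge-invariant function on the configuration space of the coarser graph,
then its pullback `ψ ∘ R` along the refinement map is gauge invariant for the finer graph. -/
theorem pullback_gauge_invariant
    {G : Type*} [Group G]
    {Vi Ei Vj Ej : Type*}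
    (si ti : Ei → Vi) (sj tj : Ej → Vj)
    (ι0 : Vi → Vj) (φ : Ei → List Ej)
    (hne : ∀ e, φ e ≠ [])
    (hhead : ∀ e, (φ e).head?.map sj = some (ι0 (si e)))
    (hlast : ∀ e, (φ e).getLast?.map tj = some (ι0 (ti e)))
    (hchain : ∀ e, (φ e).Chain' fun f f' => tj f = sj f')
    (ψ : (Ei → G) → ℂ)
    (hψ : ∀ (h : Vi → G) (a : Ei → G),
      ψ (fun e => h (si e) * a e * (h (ti e))⁻¹) = ψ a) :
    ∀ (g : Vj → G) (b : Ej → G),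
      ψ (fun e => ((φ e).map fun f => g (sj f) * b f * (g (tj f))⁻¹).prod)
        = ψ (fun e => ((φ e).map b).prod) := by
  intro g b
  rw [← hψ (fun v => g (ι0 v)) fun e => ((φ e).map b).prod]
  congr 1
  funext e
  exact prod_map_gauge_of_isChain sj tj g b (φ e) _ _ (hchain e) (hhead e) (hlast e)
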